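/- Let X be a complete metric space, U a closed process on X, and D a universe in X. Suppose there is a family D̂₀ = {D₀(t) : t ∈ ℝ} of nonempty subsets of X which is pullback D-absorbing for U, and U is pullback D̂₀-asymptotically compact. Then for every family D̂ ∈ D and every t ∈ ℝ, the pullback omega-limit set Λ(D̂,t) is a nonempty compact subset of X and it pullback attracts D̂: lim_{τ→−∞} dist(U(t,τ)D(τ), Λ(D̂,t)) = 0. -/

import Mathlib

open Filter Topology

/-- The pullback omega-limit set `Λ(D̂,t) = ⋂_{s ≤ t} cl(⋃_{τ ≤ s} U(t,τ)D(τ))`. -/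
def pullbackOmega {X : Type*} [TopologicalSpace X]
    (U : ℝ → ℝ → X → X) (Dh : ℝ → Set X) (t : ℝ) : Set X :=
  ⋂ s ∈ Set.Iic t, closure (⋃ τ ∈ Set.Iic s, U t τ '' Dh τ)

/-- The Hausdorff semidistance `dist(A,B) = sup_{a ∈ A} inf_{b ∈ B} d(a,b)`
(valued in `ℝ≥0∞`). -/
noncomputable def semidist {X : Type*} [MetricSpace X] (A B : Set X) : ENNReal :=
  ⨆ a ∈ A, EMetric.infEdist a B

section PullbackOmega

variable {X : Type*} {U : ℝ → ℝ → X → X} {Dh : ℝ → Set X} {t : ℝ}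

theorem mem_pullbackOmega_of_tendsto [TopologicalSpace X] {τ : ℕ → ℝ} {x : ℕ → X} {y : X}
    (hτ : Tendsto τ atTop atBot) (hx : ∀ n, x n ∈ Dh (τ n))
    (hy : Tendsto (fun n => U t (τ n) (x n)) atTop (𝓝 y)) : y ∈ pullbackOmega U Dh t := by
  refine Set.mem_iInter₂.2 fun s _ => mem_closure_of_tendsto hy ?_
  filter_upwards [hτ.eventually_le_atBot s] with n hn
  exact Set.mem_iUnion₂.2 ⟨τ n, hn, Set.mem_image_of_mem _ (hx n)⟩

theorem tendsto_atBot_of_le_sub_natCast {τ : ℕ → ℝ} (hτ : ∀ n, τ n ≤ t - n) :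
    Tendsto τ atTop atBot :=
  tendsto_atBot_mono hτ <| by
    simpa only [sub_eq_add_neg, Function.comp_apply] using tendsto_atBot_add_const_left _ t
      (tendsto_neg_atTop_atBot.comp (tendsto_natCast_atTop_atTop (R := ℝ)))

/-- Pullback asymptotic compactness passes from an absorbing family to the families it absorbs. -/
theorem exists_subseq_tendsto_of_pullback_absorbing [MetricSpace X]
    (hcomp : ∀ ⦃τ s t : ℝ⦄, τ ≤ s → s ≤ t → ∀ x : X, U t s (U s τ x) = U t τ x)
    {D₀ : ℝ → Set X}
    (habs : ∀ t : ℝ, ∃ τ₀ ≤ t, ∀ τ ≤ τ₀, U t τ '' Dh τ ⊆ D₀ t)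
    (hac : ∀ (τn : ℕ → ℝ) (xn : ℕ → X),
      (∀ n, τn n ≤ t) → Tendsto τn atTop atBot → (∀ n, xn n ∈ D₀ (τn n)) →
      IsCompact (closure (Set.range fun n => U t (τn n) (xn n))))
    {τ : ℕ → ℝ} {x : ℕ → X} (hτ : Tendsto τ atTop atBot) (hx : ∀ n, x n ∈ Dh (τ n)) :
    ∃ (y : X) (φ : ℕ → ℕ), StrictMono φ ∧
      Tendsto (fun n => U t (τ (φ n)) (x (φ n))) atTop (𝓝 y) := by
  choose τ₀ hτ₀ hsub using habs
  obtain ⟨k, hk, hkτ⟩ := extraction_forall_of_eventually'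
    (P := fun n k => τ k ≤ τ₀ (t - n))
    fun n => eventually_atTop.1 (hτ.eventually_le_atBot (τ₀ (t - n)))
  have hle (n : ℕ) : t - (n : ℝ) ≤ t := sub_le_self t n.cast_nonneg
  have hK := hac (fun n => t - n) (fun n => U (t - n) (τ (k n)) (x (k n))) hle
    (tendsto_atBot_of_le_sub_natCast fun _ => le_rfl)
    fun n => hsub _ _ (hkτ n) (Set.mem_image_of_mem _ (hx _))
  obtain ⟨y, -, φ, hφ, hy⟩ := hK.tendsto_subseq fun n => subset_closure (Set.mem_range_self n)
  refine ⟨y, k ∘ φ, hk.comp hφ, hy.congr fun n => ?_⟩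
  exact hcomp ((hkτ _).trans (hτ₀ _)) (hle _) _

theorem exists_dist_lt_of_mem_pullbackOmega [MetricSpace X] {y : X}
    (hy : y ∈ pullbackOmega U Dh t) {s : ℝ} (hs : s ≤ t) {ε : ℝ} (hε : 0 < ε) :
    ∃ τ ≤ s, ∃ x ∈ Dh τ, dist y (U t τ x) < ε := by
  obtain ⟨z, hz, hyz⟩ := Metric.mem_closure_iff.1 (Set.mem_iInter₂.1 hy s hs) ε hε
  obtain ⟨τ, hτ, x, hx, rfl⟩ := Set.mem_iUnion₂.1 hz
  exact ⟨τ, hτ, x, hx, hyz⟩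

end PullbackOmega

/-- For a closed process with pullback `𝒟`-absorbing family `D₀` and pullback
`D̂₀`-asymptotic compactness, every pullback omega-limit set `Λ(D̂,t)` (for `D̂ ∈ 𝒟`)
is nonempty, compact, and pullback attracts `D̂`. -/
theorem pullbackOmega_nonempty_compact_attracts
    {X : Type*} [MetricSpace X] [CompleteSpace X]
    (U : ℝ → ℝ → X → X)
    (hid : ∀ τ : ℝ, ∀ x : X, U τ τ x = x)
    (hcomp : ∀ ⦃τ s t : ℝ⦄, τ ≤ s → s ≤ t → ∀ x : X, U t s (U s τ x) = U t τ x)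
    -- U is a closed process
    (hclosed : ∀ ⦃τ t : ℝ⦄, τ ≤ t → ∀ (xn : ℕ → X) (x y : X),
      Tendsto xn atTop (𝓝 x) → Tendsto (fun n => U t τ (xn n)) atTop (𝓝 y) →
      y = U t τ x)
    (𝒟 : Set (ℝ → Set X)) (h𝒟ne : 𝒟.Nonempty)
    (h𝒟 : ∀ Dh ∈ 𝒟, ∀ t : ℝ, (Dh t).Nonempty)
    (D₀ : ℝ → Set X) (hD₀ : ∀ t : ℝ, (D₀ t).Nonempty)
    -- D₀ is pullback 𝒟-absorbing
    (habs : ∀ Dh ∈ 𝒟, ∀ t : ℝ, ∃ τ₀ ≤ t, ∀ τ ≤ τ₀, U t τ '' Dh τ ⊆ D₀ t)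
    -- U is pullback D̂₀-asymptotically compact
    (hac : ∀ t : ℝ, ∀ (τn : ℕ → ℝ) (xn : ℕ → X),
      (∀ n, τn n ≤ t) → Tendsto τn atTop atBot → (∀ n, xn n ∈ D₀ (τn n)) →
      IsCompact (closure (Set.range fun n => U t (τn n) (xn n)))) :
    ∀ Dh ∈ 𝒟, ∀ t : ℝ,
      (pullbackOmega U Dh t).Nonempty ∧
      IsCompact (pullbackOmega U Dh t) ∧
      Tendsto (fun τ => semidist (U t τ '' Dh τ) (pullbackOmega U Dh t)) atBot (𝓝 0) := by
  intro Dh hDh t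
  have hle (n : ℕ) : t - (n : ℝ) ≤ t := sub_le_self t n.cast_nonneg
  have key {τ : ℕ → ℝ} {x : ℕ → X} (hτ : ∀ n, τ n ≤ t - n) (hx : ∀ n, x n ∈ Dh (τ n)) :
      ∃ y ∈ pullbackOmega U Dh t, ∃ φ : ℕ → ℕ, StrictMono φ ∧
        Tendsto (fun n => U t (τ (φ n)) (x (φ n))) atTop (𝓝 y) := by
    have hτ' := tendsto_atBot_of_le_sub_natCast hτ
    obtain ⟨y, φ, hφ, hy⟩ :=
      exists_subseq_tendsto_of_pullback_absorbing hcomp (habs Dh hDh) (hac t) hτ' hx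
    exact ⟨y, mem_pullbackOmega_of_tendsto (hτ'.comp hφ.tendsto_atTop) (fun n => hx (φ n)) hy,
      φ, hφ, hy⟩
  refine ⟨?_, ?_, ?_⟩
  · choose x hx using fun n : ℕ => h𝒟 Dh hDh (t - n)
    obtain ⟨y, hy, -⟩ := key (fun _ => le_rfl) hx
    exact ⟨y, hy⟩
  · refine IsSeqCompact.isCompact fun y hy => ?_
    choose τ hτ x hx hyx using fun n : ℕ =>
      exists_dist_lt_of_mem_pullbackOmega (hy n) (hle n) (Nat.one_div_pos_of_nat (α := ℝ) (n := n))
    obtain ⟨z, hz, φ, hφ, hlim⟩ := key hτ hx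
    refine ⟨z, hz, φ, hφ, hlim.congr_dist ?_⟩
    refine squeeze_zero (fun _ => dist_nonneg) (fun n => ?_)
      (tendsto_one_div_add_atTop_nhds_zero_nat.comp hφ.tendsto_atTop)
    rw [dist_comm]
    exact (hyx (φ n)).le
  · refine ENNReal.tendsto_nhds_zero.2 fun ε hε => ?_
    by_contra hcon
    have hfar (n : ℕ) : ∃ τ ≤ t - n, ∃ x ∈ Dh τ,
        ε < Metric.infEDist (U t τ x) (pullbackOmega U Dh t) := by
      by_contra! hnear
      refine hcon ?_
      filter_upwards [eventually_le_atBot (t - n)] with τ hτ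
      refine iSup₂_le ?_
      rintro _ ⟨x, hx, rfl⟩
      exact hnear τ hτ x hx
    choose τ hτ x hx hd using hfar
    obtain ⟨z, hz, φ, -, hlim⟩ := key hτ hx
    obtain ⟨n, hn⟩ := ((tendsto_iff_edist_tendsto_0.1 hlim).eventually_lt_const hε).exists
    exact ((hd (φ n)).trans_le (Metric.infEDist_le_edist_of_mem hz)).not_gt hn
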